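/- arXiv:2503.04203 — 2 statements merged into one kernel-verified Lean document; each statement's English description precedes it below -/
import Mathlib

section
/- Consider a finite discounted MDP with n states, normalized with optimal policy π* and advantage gap δ > 0 (r^{π*(s)} = 0 for all s, and r^a ≤ −δ for all actions a not in the range of π*). Let P* be the stochastic matrix with rows p^{π*(s)}, and suppose there are N ≥ 1 and ω > 0 such that every entry of (P*)^N is at least ω. Let V_0 : S → ℝ with sp(V_0) > 0 and define V_{t+1} = T V_t. Set τ = 1 − n·ω·( min(1, δ/(γ·sp(V_0))) )^N. Then τ ∈ [0,1) and for every t ≥ 0, sp(V_t) ≤ γ^t · τ^{⌊t/N⌋} · sp(V_0). -/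
/-- A finite discounted MDP: states `S`, actions `A`, each action `a` available
at state `st a`, with transition probability vector `p a`, reward `r a`, and
discount factor `γ ∈ (0,1)`. -/
structure FMDP (S A : Type) [Fintype S] [Fintype A] where
  st : A → S
  st_surj : ∀ s : S, ∃ a, st a = s
  p : A → S → ℝ
  p_nonneg : ∀ a i, 0 ≤ p a i
  p_sum : ∀ a, ∑ i, p a i = 1
  r : A → ℝ
  γ : ℝ
  γ_pos : 0 < γ
  γ_lt_one : γ < 1

/-- The Bellman optimality operator `(TV)(s) = max_{a : st a = s} (r a + γ ∑ i, p a i * V i)`. -/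
noncomputable def FMDP.T {S A : Type} [Fintype S] [Fintype A] [DecidableEq S]
    (M : FMDP S A) (V : S → ℝ) (s : S) : ℝ :=
  (Finset.univ.filter fun a => M.st a = s).sup'
    (by obtain ⟨a, ha⟩ := M.st_surj s; exact ⟨a, by simp [ha]⟩)
    (fun a => M.r a + M.γ * ∑ i, M.p a i * V i)

/-- The span `max_i V i - min_i V i` of a value vector. -/
noncomputable def sp {S : Type} [Fintype S] [Nonempty S] (V : S → ℝ) : ℝ :=
  Finset.univ.sup' Finset.univ_nonempty V - Finset.univ.inf' Finset.univ_nonempty V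

section SpanDecay

open Matrix

lemma le_sup_univ {S : Type} [Fintype S] [Nonempty S] (V : S → ℝ) (i : S) :
    V i ≤ Finset.univ.sup' Finset.univ_nonempty V :=
  Finset.le_sup' V (Finset.mem_univ i)

lemma inf_univ_le {S : Type} [Fintype S] [Nonempty S] (V : S → ℝ) (i : S) :
    Finset.univ.inf' Finset.univ_nonempty V ≤ V i :=
  Finset.inf'_le V (Finset.mem_univ i)

lemma sp_le_sub {S : Type} [Fintype S] [Nonempty S] {V : S → ℝ} {a b : ℝ}
    (ha : ∀ i, a ≤ V i) (hb : ∀ i, V i ≤ b) : sp V ≤ b - a :=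
  sub_le_sub (Finset.sup'_le _ _ fun i _ => hb i) (Finset.le_inf' _ _ fun i _ => ha i)

lemma sp_nonneg {S : Type} [Fintype S] [Nonempty S] (V : S → ℝ) : 0 ≤ sp V :=
  let i := Classical.arbitrary S
  sub_nonneg.2 ((inf_univ_le V i).trans (le_sup_univ V i))

namespace FMDP

variable {S A : Type} [Fintype S] [Fintype A] (M : FMDP S A)

lemma sum_p_mul_le {V : S → ℝ} {b : ℝ} (hb : ∀ i, V i ≤ b) (a : A) :
    ∑ i, M.p a i * V i ≤ b :=
  calc ∑ i, M.p a i * V i ≤ ∑ i, M.p a i * b :=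
        Finset.sum_le_sum fun i _ => mul_le_mul_of_nonneg_left (hb i) (M.p_nonneg a i)
    _ = b := by rw [← Finset.sum_mul, M.p_sum, one_mul]

lemma le_sum_p_mul {V : S → ℝ} {b : ℝ} (hb : ∀ i, b ≤ V i) (a : A) :
    b ≤ ∑ i, M.p a i * V i :=
  calc b = ∑ i, M.p a i * b := by rw [← Finset.sum_mul, M.p_sum, one_mul]
    _ ≤ ∑ i, M.p a i * V i :=
        Finset.sum_le_sum fun i _ => mul_le_mul_of_nonneg_left (hb i) (M.p_nonneg a i)

/-- The transition matrix of a stationary policy. -/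
def policyMatrix (π : S → A) : Matrix S S ℝ := Matrix.of fun s i => M.p (π s) i

lemma policyMatrix_mulVec (π : S → A) (V : S → ℝ) (s : S) :
    (M.policyMatrix π *ᵥ V) s = ∑ i, M.p (π s) i * V i := rfl

lemma policyMatrix_mulVec_mono (π : S → A) {U V : S → ℝ} (h : ∀ i, U i ≤ V i) (s : S) :
    (M.policyMatrix π *ᵥ U) s ≤ (M.policyMatrix π *ᵥ V) s :=
  Finset.sum_le_sum fun i _ => mul_le_mul_of_nonneg_left (h i) (M.p_nonneg _ i)

variable [DecidableEq S]

lemma policyMatrix_mem_rowStochastic (π : S → A) :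
    M.policyMatrix π ∈ rowStochastic ℝ S := by
  refine ⟨fun i j => M.p_nonneg _ _, ?_⟩
  ext s
  simp [policyMatrix_mulVec, M.p_sum]

lemma le_T (V : S → ℝ) (a : A) :
    M.r a + M.γ * ∑ i, M.p a i * V i ≤ M.T V (M.st a) :=
  Finset.le_sup' (fun a => M.r a + M.γ * ∑ i, M.p a i * V i) (by simp)

lemma exists_T_eq (V : S → ℝ) (s : S) :
    ∃ a, M.st a = s ∧ M.T V s = M.r a + M.γ * ∑ i, M.p a i * V i := by
  obtain ⟨a, ha, h⟩ := Finset.exists_mem_eq_sup' (s := Finset.univ.filter fun a => M.st a = s)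
    (by obtain ⟨a, ha⟩ := M.st_surj s; exact ⟨a, by simp [ha]⟩)
    (fun a => M.r a + M.γ * ∑ i, M.p a i * V i)
  exact ⟨a, by simpa using ha, h⟩

variable {M} {π : S → A}

lemma T_le (hr : ∀ a, M.r a ≤ 0) {V : S → ℝ} {b : ℝ} (hb : ∀ i, V i ≤ b) (s : S) :
    M.T V s ≤ M.γ * b := by
  obtain ⟨a, -, h⟩ := M.exists_T_eq V s
  rw [h]
  linarith [hr a, mul_le_mul_of_nonneg_left (M.sum_p_mul_le hb a) M.γ_pos.le]

lemma policyMatrix_mulVec_le_T (hπ : ∀ s, M.st (π s) = s) (hr0 : ∀ s, M.r (π s) = 0)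
    (V : S → ℝ) (s : S) : M.γ * (M.policyMatrix π *ᵥ V) s ≤ M.T V s := by
  have h := M.le_T V (π s)
  rwa [hπ, hr0, zero_add] at h

lemma le_T_of_le (hπ : ∀ s, M.st (π s) = s) (hr0 : ∀ s, M.r (π s) = 0)
    {V : S → ℝ} {b : ℝ} (hb : ∀ i, b ≤ V i) (s : S) : M.γ * b ≤ M.T V s :=
  (mul_le_mul_of_nonneg_left (M.le_sum_p_mul hb (π s)) M.γ_pos.le).trans
    (policyMatrix_mulVec_le_T hπ hr0 V s)

/-- The deficit of `T V` below the bound `γ b` dominates a damped average, under the optimal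
policy, of the deficit of `V` below `b`. -/
lemma mulVec_deficit_le (hπ : ∀ s, M.st (π s) = s) (hr0 : ∀ s, M.r (π s) = 0)
    {δ c a b : ℝ} (hgap : ∀ x, x ∉ Set.range π → M.r x ≤ -δ)
    (hc0 : 0 ≤ c) (hc1 : c ≤ 1) (hc : c * M.γ * (b - a) ≤ δ)
    {V : S → ℝ} (ha : ∀ i, a ≤ V i) (hb : ∀ i, V i ≤ b) (s : S) :
    c * M.γ * (M.policyMatrix π *ᵥ fun i => b - V i) s ≤ M.γ * b - M.T V s := by
  have hγ := M.γ_pos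
  have hsum : ∀ x, ∑ i, M.p x i * (b - V i) = b - ∑ i, M.p x i * V i := fun x => by
    simp only [mul_sub, Finset.sum_sub_distrib, ← Finset.sum_mul, M.p_sum, one_mul]
  rw [policyMatrix_mulVec, hsum]
  obtain ⟨x, hx, h⟩ := M.exists_T_eq V s
  rw [h]
  have h1 := M.sum_p_mul_le hb x
  by_cases hxr : x ∈ Set.range π
  · obtain ⟨s', rfl⟩ := hxr
    obtain rfl : s' = s := by rw [← hπ s', hx]
    rw [hr0]
    have := mul_le_mul_of_nonneg_right hc1 (mul_nonneg hγ.le (sub_nonneg.2 h1))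
    linarith
  · have h2 := mul_le_mul_of_nonneg_left
      (sub_le_sub_left (M.le_sum_p_mul ha (π s)) b) (mul_nonneg hc0 hγ.le)
    have h3 := mul_le_mul_of_nonneg_left h1 hγ.le
    linarith [hgap x hxr]

section Iterate

variable {W : ℕ → S → ℝ}

lemma iterate_le (hr : ∀ a, M.r a ≤ 0) (hW : ∀ t, W (t + 1) = M.T (W t)) {b : ℝ}
    (hb : ∀ i, W 0 i ≤ b) (k : ℕ) (s : S) : W k s ≤ M.γ ^ k * b := by
  induction k generalizing s with
  | zero => simpa using hb s
  | succ k ih => rw [hW, pow_succ', mul_assoc]; exact T_le hr ih s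

lemma le_iterate (hπ : ∀ s, M.st (π s) = s) (hr0 : ∀ s, M.r (π s) = 0)
    (hW : ∀ t, W (t + 1) = M.T (W t)) {a : ℝ}
    (ha : ∀ i, a ≤ W 0 i) (k : ℕ) (s : S) : M.γ ^ k * a ≤ W k s := by
  induction k generalizing s with
  | zero => simpa using ha s
  | succ k ih => rw [hW, pow_succ', mul_assoc]; exact le_T_of_le hπ hr0 ih s

lemma pow_mulVec_le_iterate (hπ : ∀ s, M.st (π s) = s) (hr0 : ∀ s, M.r (π s) = 0)
    (hW : ∀ t, W (t + 1) = M.T (W t)) (k : ℕ) (s : S) :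
    M.γ ^ k * (M.policyMatrix π ^ k *ᵥ W 0) s ≤ W k s := by
  induction k generalizing s with
  | zero => simp
  | succ k ih =>
    rw [hW]
    refine le_trans ?_ (policyMatrix_mulVec_le_T hπ hr0 (W k) s)
    have h := M.policyMatrix_mulVec_mono π
      (U := M.γ ^ k • (M.policyMatrix π ^ k *ᵥ W 0)) ih s
    rw [mulVec_smul, mulVec_mulVec, ← pow_succ'] at h
    rw [pow_succ', mul_assoc]
    exact mul_le_mul_of_nonneg_left h M.γ_pos.le

lemma pow_mulVec_deficit_le (hπ : ∀ s, M.st (π s) = s) (hr0 : ∀ s, M.r (π s) = 0)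
    (hr : ∀ a, M.r a ≤ 0) (hW : ∀ t, W (t + 1) = M.T (W t))
    {δ c a b : ℝ} (hgap : ∀ x, x ∉ Set.range π → M.r x ≤ -δ)
    (hc0 : 0 ≤ c) (hc1 : c ≤ 1) (hab : a ≤ b) (hc : c * M.γ * (b - a) ≤ δ)
    (ha : ∀ i, a ≤ W 0 i) (hb : ∀ i, W 0 i ≤ b) (k : ℕ) (s : S) :
    (c * M.γ) ^ k * (M.policyMatrix π ^ k *ᵥ fun i => b - W 0 i) s ≤ M.γ ^ k * b - W k s := by
  have hcγ := mul_nonneg hc0 M.γ_pos.le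
  induction k generalizing s with
  | zero => simp
  | succ k ih =>
    have hk : c * M.γ * (M.γ ^ k * b - M.γ ^ k * a) ≤ δ := by
      rw [← mul_sub]
      refine le_trans (mul_le_mul_of_nonneg_left ?_ hcγ) hc
      exact mul_le_of_le_one_left (sub_nonneg.2 hab) (pow_le_one₀ M.γ_pos.le M.γ_lt_one.le)
    have h1 := mulVec_deficit_le hπ hr0 hgap hc0 hc1 hk
      (le_iterate hπ hr0 hW ha k) (iterate_le hr hW hb k) s
    have h2 := M.policyMatrix_mulVec_mono π
      (U := (c * M.γ) ^ k • (M.policyMatrix π ^ k *ᵥ fun i => b - W 0 i)) ih s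
    rw [mulVec_smul, mulVec_mulVec, ← pow_succ'] at h2
    rw [hW, pow_succ' M.γ, mul_assoc M.γ]
    refine le_trans ?_ h1
    rw [pow_succ' (c * M.γ), mul_assoc (c * M.γ)]
    exact mul_le_mul_of_nonneg_left h2 hcγ

variable [Nonempty S]

lemma sp_iterate_le (hπ : ∀ s, M.st (π s) = s) (hr0 : ∀ s, M.r (π s) = 0)
    (hr : ∀ a, M.r a ≤ 0) (hW : ∀ t, W (t + 1) = M.T (W t)) (k : ℕ) :
    sp (W k) ≤ M.γ ^ k * sp (W 0) := by
  refine (sp_le_sub (le_iterate hπ hr0 hW (inf_univ_le (W 0)) k)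
    (iterate_le hr hW (le_sup_univ (W 0)) k)).trans_eq ?_
  rw [← mul_sub, sp]

/-- If every entry of the `N`-th power of the optimal transition matrix is at least `ω`, then
`N` steps of Value Iteration contract the span by `γ ^ N * (1 - n ω c ^ N)`. -/
lemma sp_iterate_le_of_mixing (hπ : ∀ s, M.st (π s) = s) (hr0 : ∀ s, M.r (π s) = 0)
    (hr : ∀ a, M.r a ≤ 0) (hW : ∀ t, W (t + 1) = M.T (W t))
    {δ c ω : ℝ} (hgap : ∀ x, x ∉ Set.range π → M.r x ≤ -δ)
    (hc0 : 0 ≤ c) (hc1 : c ≤ 1) (hc : c * M.γ * sp (W 0) ≤ δ) {N : ℕ} (hω : 0 ≤ ω)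
    (hmix : ∀ i j, ω ≤ (M.policyMatrix π ^ N) i j) :
    sp (W N) ≤ M.γ ^ N * (1 - Fintype.card S * ω * c ^ N) * sp (W 0) := by
  set b := Finset.univ.sup' Finset.univ_nonempty (W 0)
  set a := Finset.univ.inf' Finset.univ_nonempty (W 0)
  have hspab : sp (W 0) = b - a := rfl
  have hab : a ≤ b := sub_nonneg.1 (sp_nonneg (W 0))
  have hγN := pow_nonneg M.γ_pos.le N
  have hcN := pow_nonneg hc0 N
  have hQ := pow_mem (M.policyMatrix_mem_rowStochastic π) N
  have mix : ∀ D : S → ℝ, (∀ i, 0 ≤ D i) → ∀ s,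
      ω * ∑ i, D i ≤ (M.policyMatrix π ^ N *ᵥ D) s := fun D hD s => by
    rw [Finset.mul_sum]
    exact Finset.sum_le_sum fun i _ => mul_le_mul_of_nonneg_right (hmix s i) (hD i)
  have upper : ∀ s, W N s ≤ M.γ ^ N * (b - c ^ N * (ω * ∑ i, (b - W 0 i))) := fun s => by
    have h1 := pow_mulVec_deficit_le hπ hr0 hr hW hgap hc0 hc1 hab hc
      (inf_univ_le (W 0)) (le_sup_univ (W 0)) N s
    have h2 := mul_le_mul_of_nonneg_left
      (mix (fun i => b - W 0 i) (fun i => sub_nonneg.2 (le_sup_univ (W 0) i)) s)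
      (mul_nonneg hcN hγN)
    rw [mul_pow] at h1
    linarith
  have lower : ∀ s, M.γ ^ N * (a + c ^ N * (ω * ∑ i, (W 0 i - a))) ≤ W N s := fun s => by
    have hD : ∀ i, 0 ≤ W 0 i - a := fun i => sub_nonneg.2 (inf_univ_le (W 0) i)
    refine le_trans (mul_le_mul_of_nonneg_left ?_ hγN) (pow_mulVec_le_iterate hπ hr0 hW N s)
    have h1 := mix _ hD s
    have h2 : (M.policyMatrix π ^ N *ᵥ fun i => W 0 i - a) s
        = (M.policyMatrix π ^ N *ᵥ W 0) s - a := by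
      have : (fun i => W 0 i - a) = W 0 - a • (1 : S → ℝ) := by ext; simp
      rw [this, mulVec_sub, mulVec_smul, hQ.2]
      simp
    have h3 := mul_le_of_le_one_left (mul_nonneg hω (Finset.univ.sum_nonneg fun i _ => hD i))
      (pow_le_one₀ hc0 hc1 (n := N))
    linarith
  refine (sp_le_sub lower upper).trans_eq ?_
  rw [hspab]
  simp only [Finset.sum_sub_distrib, Finset.sum_const, Finset.card_univ, nsmul_eq_mul]
  ring

end Iterate

end FMDP

end SpanDecay

/-- Quantitative span decay of synchronous Value Iteration in a normalized MDP
with advantage gap `δ`: with `τ = 1 - n ω (min 1 (δ/(γ sp V₀)))^N`, we have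
`τ ∈ [0,1)` and `sp(V_t) ≤ γ^t τ^⌊t/N⌋ sp(V₀)` for all `t`. -/
theorem stmt_8 {S A : Type} [Fintype S] [Nonempty S] [DecidableEq S] [Fintype A]
    (M : FMDP S A)
    (πstar : S → A) (hπstar : ∀ s, M.st (πstar s) = s)
    (hr0 : ∀ s, M.r (πstar s) = 0) (hrle : ∀ a, M.r a ≤ 0)
    (δ : ℝ) (hδ : 0 < δ) (hgap : ∀ a, a ∉ Set.range πstar → M.r a ≤ -δ)
    (N : ℕ) (hN : 1 ≤ N) (ω : ℝ) (hω : 0 < ω)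
    (hmix : ∀ i j : S, ω ≤ ((Matrix.of fun s i => M.p (πstar s) i) ^ N) i j)
    (V : ℕ → S → ℝ) (hsp0 : 0 < sp (V 0)) (hVI : ∀ t, V (t + 1) = M.T (V t))
    (τ : ℝ)
    (hτ : τ = 1 - (Fintype.card S : ℝ) * ω * (min 1 (δ / (M.γ * sp (V 0)))) ^ N) :
    0 ≤ τ ∧ τ < 1 ∧ ∀ t : ℕ, sp (V t) ≤ M.γ ^ t * τ ^ (t / N) * sp (V 0) := by
  have hγ := M.γ_pos
  set c := min 1 (δ / (M.γ * sp (V 0)))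
  have hc0 : 0 < c := lt_min one_pos (by positivity)
  have hc1 : c ≤ 1 := min_le_left _ _
  have hc : c * (M.γ * sp (V 0)) ≤ δ := (le_div_iff₀ (by positivity)).1 (min_le_right _ _)
  have hcN : c ^ N ≤ 1 := pow_le_one₀ hc0.le hc1
  have hQ := pow_mem (M.policyMatrix_mem_rowStochastic πstar) N
  have hnω : (Fintype.card S : ℝ) * ω ≤ 1 := by
    rw [← Matrix.sum_row_of_mem_rowStochastic hQ (Classical.arbitrary S), ← nsmul_eq_mul,
      ← Finset.card_univ]
    exact Finset.card_nsmul_le_sum _ _ _ fun j _ => hmix _ j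
  have hcard : (0 : ℝ) < Fintype.card S := by exact_mod_cast Fintype.card_pos
  have hpos : 0 < (Fintype.card S : ℝ) * ω * c ^ N := by positivity
  have hτ0 : 0 ≤ τ := by
    rw [hτ, sub_nonneg]
    exact mul_le_one₀ hnω (by positivity) hcN
  have shift : ∀ u t, V (u + (t + 1)) = M.T (V (u + t)) := fun u t => hVI (u + t)
  have step : ∀ u k, sp (V (u + k)) ≤ M.γ ^ k * sp (V u) := fun u k =>
    FMDP.sp_iterate_le (W := fun t => V (u + t)) hπstar hr0 hrle (shift u) k
  have block : ∀ u, sp (V (u + N)) ≤ M.γ ^ N * τ * sp (V u) := fun u => by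
    have hu : sp (V u) ≤ sp (V 0) := by
      have h := step 0 u
      rw [zero_add] at h
      exact h.trans (mul_le_of_le_one_left hsp0.le (pow_le_one₀ hγ.le M.γ_lt_one.le))
    have hcu : c * M.γ * sp (V u) ≤ δ :=
      (mul_le_mul_of_nonneg_left hu (by positivity)).trans ((mul_assoc _ _ _).trans_le hc)
    rw [hτ]
    exact FMDP.sp_iterate_le_of_mixing (W := fun t => V (u + t)) hπstar hr0 hrle (shift u) hgap
      hc0.le hc1 hcu hω.le hmix
  have blocks : ∀ q, sp (V (N * q)) ≤ M.γ ^ (N * q) * τ ^ q * sp (V 0) := fun q => by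
    induction q with
    | zero => simp
    | succ q ih =>
      rw [Nat.mul_succ]
      refine (block _).trans ((mul_le_mul_of_nonneg_left ih (by positivity)).trans_eq ?_)
      ring
  refine ⟨hτ0, by linarith, fun t => ?_⟩
  have h := (step (N * (t / N)) (t % N)).trans
    (mul_le_mul_of_nonneg_left (blocks (t / N)) (by positivity))
  rw [Nat.div_add_mod] at h
  refine h.trans_eq ?_
  nth_rewrite 4 [← Nat.div_add_mod t N]
  rw [pow_add]
  ring
end

section
/- Consider a finite discounted MDP with discount factor γ ∈ (0,1). Let a be an action with s = st(a) and probability vector p^a, and let V, W : S → ℝ be any two value vectors with e = V − W. Then | Adv(a, V) − Adv(a, W) | ≤ γ·(1 − p^a_s)·sp(e) + (1−γ)·max_i |e(i)|, where Adv(a,U) = r^a + γ Σ_i p^a_i U(i) − U(s). Moreover the exact identity Adv(a,V) − Adv(a,W) = −(1−γ)·e(s) + γ Σ_{i≠s} p^a_i (e(i) − e(s)) holds. -/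
theorem sub_le_sp {S : Type} [Fintype S] [Nonempty S] (e : S → ℝ) (i j : S) :
    e i - e j ≤ sp e :=
  sub_le_sub (Finset.le_sup' e (Finset.mem_univ i)) (Finset.inf'_le e (Finset.mem_univ j))

theorem abs_sub_le_sp {S : Type} [Fintype S] [Nonempty S] (e : S → ℝ) (i j : S) :
    |e i - e j| ≤ sp e :=
  abs_sub_le_iff.2 ⟨sub_le_sp e i j, sub_le_sp e j i⟩

/-- The advantage-perturbation identity and bound: for an action `a` at state
`s` and value vectors `V, W` with `e = V - W`,
`Adv(a,V) - Adv(a,W) = -(1-γ) e(s) + γ ∑_{i≠s} p^a_i (e(i) - e(s))` and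
`|Adv(a,V) - Adv(a,W)| ≤ γ (1 - p^a_s) sp(e) + (1-γ) max_i |e(i)|`. -/
theorem stmt_16 {S A : Type} [Fintype S] [Nonempty S] [DecidableEq S] [Fintype A]
    (st : A → S)
    (p : A → S → ℝ) (hp0 : ∀ a i, 0 ≤ p a i) (hp1 : ∀ a, ∑ i, p a i = 1)
    (r : A → ℝ) (γ : ℝ) (hγ0 : 0 < γ) (hγ1 : γ < 1)
    (a : A) (s : S) (has : st a = s)
    (V W e : S → ℝ) (he : ∀ i, e i = V i - W i) :
    |(r a + γ * ∑ i, p a i * V i - V s) - (r a + γ * ∑ i, p a i * W i - W s)| ≤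
        γ * (1 - p a s) * sp e +
          (1 - γ) * Finset.univ.sup' Finset.univ_nonempty (fun i => |e i|) ∧
    (r a + γ * ∑ i, p a i * V i - V s) - (r a + γ * ∑ i, p a i * W i - W s) =
      -((1 - γ) * e s) + γ * ∑ i ∈ Finset.univ.erase s, p a i * (e i - e s) := by
  have hp_erase : ∑ i ∈ Finset.univ.erase s, p a i = 1 - p a s := by
    rw [Finset.sum_erase_eq_sub (Finset.mem_univ s), hp1]
  have h_sum : ∑ i ∈ Finset.univ.erase s, p a i * (e i - e s) =
      ∑ i, p a i * V i - ∑ i, p a i * W i - e s := by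
    rw [Finset.sum_erase _ (by simp)]
    simp only [mul_sub, Finset.sum_sub_distrib, ← Finset.sum_mul, hp1, he, one_mul]
  have h_eq : (r a + γ * ∑ i, p a i * V i - V s) - (r a + γ * ∑ i, p a i * W i - W s) =
      -((1 - γ) * e s) + γ * ∑ i ∈ Finset.univ.erase s, p a i * (e i - e s) := by
    rw [h_sum, he]
    ring
  refine ⟨?_, h_eq⟩
  have h_span : |∑ i ∈ Finset.univ.erase s, p a i * (e i - e s)| ≤ (1 - p a s) * sp e := by
    rw [← hp_erase, Finset.sum_mul]
    refine (Finset.abs_sum_le_sum_abs _ _).trans (Finset.sum_le_sum fun i _ => ?_)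
    rw [abs_mul, abs_of_nonneg (hp0 a i)]
    exact mul_le_mul_of_nonneg_left (abs_sub_le_sp e i s) (hp0 a i)
  have h_max : |e s| ≤ Finset.univ.sup' Finset.univ_nonempty (fun i => |e i|) :=
    Finset.le_sup' (fun i => |e i|) (Finset.mem_univ s)
  rw [h_eq]
  refine (abs_add_le _ _).trans ?_
  rw [abs_neg, abs_mul, abs_mul, abs_of_pos hγ0, abs_of_pos (sub_pos.2 hγ1), add_comm, mul_assoc]
  exact add_le_add (mul_le_mul_of_nonneg_left h_span hγ0.le)
    (mul_le_mul_of_nonneg_left h_max (sub_pos.2 hγ1).le)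
end
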